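/- Let H be an M×K complex matrix with Hᴴ·H invertible. Then lim_{z→0⁺} (z·I_M + H·Hᴴ)⁻¹·H = H·(Hᴴ·H)⁻¹, i.e., the regularized zero-forcing precoder converges to the zero-forcing precoder as the regularization parameter tends to zero. -/

import Mathlib

open Matrix Filter Topology

open scoped ComplexOrder in
theorem rzf_aux_isUnit {m k : ℕ} (A : Matrix (Fin m) (Fin k) ℂ) (z : ℝ) (hz : 0 < z) :
    IsUnit ((z : ℂ) • (1 : Matrix (Fin m) (Fin m) ℂ) + A * Aᴴ) := by
  have h1 : ((z : ℂ) • (1 : Matrix (Fin m) (Fin m) ℂ)).PosDef :=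
    Matrix.PosDef.smul Matrix.PosDef.one (by exact_mod_cast hz)
  exact (h1.add_posSemidef (posSemidef_self_mul_conjTranspose A)).isUnit

/-- As the regularization parameter `z → 0⁺`, the RZF precoder
`(z•I + H*Hᴴ)⁻¹ * H` converges (entrywise) to the ZF precoder `H * (Hᴴ*H)⁻¹`,
provided `Hᴴ*H` is invertible. -/
theorem rzf_tendsto_zf (M K : ℕ) (H : Matrix (Fin M) (Fin K) ℂ)
    (hinv : IsUnit (Hᴴ * H)) :
    Tendsto (fun z : ℝ =>
        ((z : ℂ) • (1 : Matrix (Fin M) (Fin M) ℂ) + H * Hᴴ)⁻¹ * H)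
      (𝓝[>] 0) (𝓝 (H * (Hᴴ * H)⁻¹)) := by
  have hdet : (Hᴴ * H).det ≠ 0 := ((Matrix.isUnit_iff_isUnit_det _).1 hinv).ne_zero
  have hcont : ContinuousAt (fun z : ℝ =>
      H * ((z : ℂ) • (1 : Matrix (Fin K) (Fin K) ℂ) + Hᴴ * H)⁻¹) 0 := by
    have hB : Continuous (fun z : ℝ =>
        (z : ℂ) • (1 : Matrix (Fin K) (Fin K) ℂ) + Hᴴ * H) := by fun_prop
    simp only [Matrix.inv_def, Ring.inverse_eq_inv']
    have h1 : ContinuousAt (fun z : ℝ =>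
        ((z : ℂ) • (1 : Matrix (Fin K) (Fin K) ℂ) + Hᴴ * H).det⁻¹) 0 :=
      hB.matrix_det.continuousAt.inv₀ (by simpa using hdet)
    have h2 := h1.smul hB.matrix_adjugate.continuousAt
    have h3 : Continuous (fun X : Matrix (Fin K) (Fin K) ℂ => H * X) :=
      continuous_const.matrix_mul continuous_id
    exact h3.continuousAt.comp h2
  have ht := hcont.tendsto.mono_left (nhdsWithin_le_nhds (s := Set.Ioi 0))
  simp only [Complex.ofReal_zero, zero_smul, zero_add] at ht
  refine ht.congr' ?_
  filter_upwards [self_mem_nhdsWithin] with z hz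
  have hz : 0 < z := hz
  have hA := (Matrix.isUnit_iff_isUnit_det _).1 (rzf_aux_isUnit H z hz)
  have hB := rzf_aux_isUnit Hᴴ z hz
  rw [conjTranspose_conjTranspose, Matrix.isUnit_iff_isUnit_det] at hB
  have key : H * ((z : ℂ) • (1 : Matrix (Fin K) (Fin K) ℂ) + Hᴴ * H) =
      ((z : ℂ) • (1 : Matrix (Fin M) (Fin M) ℂ) + H * Hᴴ) * H := by
    simp [Matrix.mul_add, Matrix.add_mul, Matrix.mul_assoc]
  generalize (z : ℂ) • (1 : Matrix (Fin K) (Fin K) ℂ) + Hᴴ * H = B at *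
  generalize (z : ℂ) • (1 : Matrix (Fin M) (Fin M) ℂ) + H * Hᴴ = A at *
  calc H * B⁻¹ = A⁻¹ * (A * H) * B⁻¹ := by rw [Matrix.nonsing_inv_mul_cancel_left _ _ hA]
    _ = A⁻¹ * H := by
      rw [← key, ← Matrix.mul_assoc, Matrix.mul_nonsing_inv_cancel_right _ _ hB]
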